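/- Let (G,P) = Γ_{J∈Λ}(G_J,P_J) be a graph product of quasi-lattice ordered groups, let x, y ∈ P, and for an arbitrary I ∈ Λ write x = x_I x′ and y = y_I y′. Then: (i) x and y have a common upper bound in G if and only if x and y are I-adjacent and x′ ∨ y′ ≠ ∞; and (ii) if x and y have a common upper bound, then x ∨ y = (x_I ∨ y_I)·(x′ ∨ y′). -/

import Mathlib

universe u v

/-- A syllable: a vertex `I` of the graph together with a nontrivial element of `G I`. -/
def Syllable {Λ : Type u} (G : Λ → Type v) [∀ I, Group (G I)] : Type (max u v) :=
  Σ I : Λ, {g : G I // g ≠ 1}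

section Words

variable {Λ : Type u} {G : Λ → Type v} [∀ I, Group (G I)]

/-- A single shuffle: swap two consecutive syllables with adjacent vertices. -/
def ShuffleStep (adj : Λ → Λ → Prop) (L L' : List (Syllable G)) : Prop :=
  ∃ (A B : List (Syllable G)) (s t : Syllable G),
    adj s.1 t.1 ∧ L = A ++ s :: t :: B ∧ L' = A ++ t :: s :: B

/-- Shuffle equivalence: finitely many shuffles. -/
def ShuffleEquiv (adj : Λ → Λ → Prop) : List (Syllable G) → List (Syllable G) → Prop :=
  Relation.ReflTransGen (ShuffleStep adj)

/-- An expression admits an amalgamation iff it has two consecutive syllables at the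
same vertex. -/
def Amalgamable (L : List (Syllable G)) : Prop :=
  ∃ (A B : List (Syllable G)) (s t : Syllable G), s.1 = t.1 ∧ L = A ++ s :: t :: B

/-- An expression is reduced iff it is not shuffle equivalent to an expression
admitting an amalgamation. -/
def Reduced (adj : Λ → Λ → Prop) (L : List (Syllable G)) : Prop :=
  ¬ ∃ L', ShuffleEquiv adj L L' ∧ Amalgamable L'

/-- The syllable at position `i` is an initial syllable of the expression `L`:
its vertex is adjacent to the vertices of all earlier syllables. -/
def InitialAt (adj : Λ → Λ → Prop) (L : List (Syllable G)) (i : Fin L.length) : Prop :=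
  ∀ j : Fin L.length, j < i → adj (L.get j).1 (L.get i).1

end Words

section GroupPart

variable {Λ : Type u} (adj : Λ → Λ → Prop) (G : Λ → Type v) [∀ I, Group (G I)]

/-- The graph product of the family of groups `G` over the graph `adj`: the quotient of
the free product by the normal closure of the commutators coming from adjacent vertices. -/
def GraphProduct : Type (max u v) :=
  Monoid.CoprodI G ⧸ Subgroup.normalClosure
    {g : Monoid.CoprodI G | ∃ (I J : Λ) (x : G I) (y : G J), adj I J ∧
      g = Monoid.CoprodI.of x * Monoid.CoprodI.of y *
          (Monoid.CoprodI.of x)⁻¹ * (Monoid.CoprodI.of y)⁻¹}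

instance : Group (GraphProduct adj G) :=
  inferInstanceAs (Group (_ ⧸ _))

/-- The canonical image in the graph product of an element of one of the groups. -/
def mkOf {I : Λ} (g : G I) : GraphProduct adj G :=
  QuotientGroup.mk (Monoid.CoprodI.of g)

/-- Evaluation of an expression (a word in the syllables) in the graph product. -/
def evalWord (L : List (Syllable G)) : GraphProduct adj G :=
  (L.map fun s => mkOf adj G (s.2.1 : G s.1)).prod

/-- `L` is an expression for the group element `x`. -/
def ExprFor (L : List (Syllable G)) (x : GraphProduct adj G) : Prop :=
  evalWord adj G L = x

/-- `s` is an initial syllable of the group element `x`: some reduced expression for `x`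
has `s` as an initial syllable. -/
def IsInitialSyllable (x : GraphProduct adj G) (s : Syllable G) : Prop :=
  ∃ L, Reduced adj L ∧ ExprFor adj G L x ∧ ∃ i : Fin L.length, InitialAt adj L i ∧ L.get i = s

/-- `s` is a final syllable of the group element `x`: it is an initial syllable of the
reverse of some reduced expression for `x`. -/
def IsFinalSyllable (x : GraphProduct adj G) (s : Syllable G) : Prop :=
  ∃ L, Reduced adj L ∧ ExprFor adj G L x ∧
    ∃ i : Fin L.reverse.length, InitialAt adj L.reverse i ∧ L.reverse.get i = s

/-- `I` is an initial vertex of the group element `x`, i.e. `I ∈ Δ(x)`. -/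
def InitialVertexOf (x : GraphProduct adj G) (I : Λ) : Prop :=
  ∃ s : Syllable G, IsInitialSyllable adj G x s ∧ s.1 = I

/-- `I` is a final vertex of the group element `x`, i.e. `I ∈ Δʳ(x)`. -/
def FinalVertexOf (x : GraphProduct adj G) (I : Λ) : Prop :=
  ∃ s : Syllable G, IsFinalSyllable adj G x s ∧ s.1 = I

/-- `I` is a vertex of the group element `x`: some (hence any) reduced expression
for `x` has a syllable at the vertex `I`. -/
def VertexOf (x : GraphProduct adj G) (I : Λ) : Prop :=
  ∃ L, Reduced adj L ∧ ExprFor adj G L x ∧ ∃ s ∈ L, Sigma.fst s = I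

/-- `c` is the element `x_I ∈ G_I`: either `c` is nontrivial and the initial syllable of
`x` at the vertex `I`, or `c = 1` and `I` is not an initial vertex of `x`. -/
def InitialPart (x : GraphProduct adj G) (I : Λ) (c : G I) : Prop :=
  (∃ h : c ≠ 1, IsInitialSyllable adj G x ⟨I, ⟨c, h⟩⟩) ∨ (c = 1 ∧ ¬ InitialVertexOf adj G x I)

/-- The positive cone of the graph product of partially ordered groups: the submonoid
generated by the union of the positive cones of the factors. -/
def posCone (Pc : ∀ I, Submonoid (G I)) : Submonoid (GraphProduct adj G) :=
  Submonoid.closure {g | ∃ (I : Λ) (p : G I), p ∈ Pc I ∧ g = mkOf adj G p}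

end GroupPart

section Order

variable {H : Type*} [Group H]

/-- `x ≤ y` in the left-invariant partial order determined by the cone `P`. -/
def lle (P : Submonoid H) (x y : H) : Prop := x⁻¹ * y ∈ P

/-- `x ≤ᵣ y` in the right-invariant partial order determined by the cone `P`. -/
def rle (P : Submonoid H) (x y : H) : Prop := y * x⁻¹ ∈ P

/-- `x` and `y` have a common upper bound for the left-invariant order. -/
def HasUB (P : Submonoid H) (x y : H) : Prop := ∃ z, lle P x z ∧ lle P y z

/-- `m` is a least upper bound of `x` and `y` for the left-invariant order. -/
def IsLub' (P : Submonoid H) (x y m : H) : Prop :=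
  lle P x m ∧ lle P y m ∧ ∀ w, lle P x w → lle P y w → lle P m w

/-- `w` is a greatest lower bound of `u` and `v` for the right-invariant order. -/
def IsRGlb (P : Submonoid H) (u v w : H) : Prop :=
  rle P w u ∧ rle P w v ∧ ∀ z, rle P z u → rle P z v → rle P z w

/-- `(H,P)` is a partially ordered group: `P ∩ P⁻¹ = {1}`. -/
def IsPoGroup (P : Submonoid H) : Prop := ∀ x : H, x ∈ P → x⁻¹ ∈ P → x = 1

/-- `(H,P)` is a quasi-lattice ordered group: it is a partially ordered group in which
every pair of elements with a common upper bound has a least upper bound. -/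
def IsQLO (P : Submonoid H) : Prop :=
  IsPoGroup P ∧ ∀ x y : H, HasUB P x y → ∃ m, IsLub' P x y m

end Order

/-- `x` and `y` (with initial parts `xI`, `yI` at the vertex `I` and remainders
`x′`, `y′`) are `I`-adjacent: (a) `x_I ∨ y_I ≠ ∞` in `(G_I, P_I)`; (b) either
`x_I = x_I ∨ y_I` or `I` is adjacent to every vertex of `x′`; and (c) either
`y_I = x_I ∨ y_I` or `I` is adjacent to every vertex of `y′`. -/
def IAdjacent {Λ : Type u} (adj : Λ → Λ → Prop) (G : Λ → Type v) [∀ I, Group (G I)]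
    (Pc : ∀ I, Submonoid (G I)) (I : Λ) (xI yI : G I)
    (x' y' : GraphProduct adj G) : Prop :=
  HasUB (Pc I) xI yI ∧
  (IsLub' (Pc I) xI yI xI ∨ ∀ J : Λ, VertexOf adj G x' J → adj I J) ∧
  (IsLub' (Pc I) xI yI yI ∨ ∀ J : Λ, VertexOf adj G y' J → adj I J)

set_option linter.deprecated false

section Words

variable {Λ : Type u} {G : Λ → Type v} [∀ I, Group (G I)] {adj : Λ → Λ → Prop}

/-- The syllable given by a nontrivial element of `G I`. -/
abbrev Syllable.of (I : Λ) (c : {g : G I // g ≠ 1}) : Syllable G := ⟨I, c⟩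

theorem Syllable.exists_eq_of (s : Syllable G) : ∃ I c, s = Syllable.of I c := ⟨s.1, s.2, rfl⟩

theorem ShuffleStep.cons {L M : List (Syllable G)} (s : Syllable G) (h : ShuffleStep adj L M) :
    ShuffleStep adj (s :: L) (s :: M) := by
  obtain ⟨A, B, t, u, htu, rfl, rfl⟩ := h
  exact ⟨s :: A, B, t, u, htu, rfl, rfl⟩

/-- Induction principle for shuffle steps: swap at the head, or shuffle the tail. -/
theorem ShuffleStep.induction {r : List (Syllable G) → List (Syllable G) → Prop}
    (swap : ∀ s t B, adj s.1 t.1 → r (s :: t :: B) (t :: s :: B))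
    (cons : ∀ s L M, ShuffleStep adj L M → r L M → r (s :: L) (s :: M))
    {L M : List (Syllable G)} (h : ShuffleStep adj L M) : r L M := by
  obtain ⟨A, B, s, t, hst, rfl, rfl⟩ := h
  induction A with
  | nil => exact swap s t B hst
  | cons a A ih => exact cons a _ _ ⟨A, B, s, t, hst, rfl, rfl⟩ ih

namespace ShuffleEquiv

theorem refl (L : List (Syllable G)) : ShuffleEquiv adj L L := Relation.ReflTransGen.refl

theorem of_eq {L M : List (Syllable G)} (h : L = M) : ShuffleEquiv adj L M := h ▸ refl L

theorem trans {L M N : List (Syllable G)} (h : ShuffleEquiv adj L M)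
    (h' : ShuffleEquiv adj M N) : ShuffleEquiv adj L N := Relation.ReflTransGen.trans h h'

theorem swap {s t : Syllable G} (h : adj s.1 t.1) (L : List (Syllable G)) :
    ShuffleEquiv adj (s :: t :: L) (t :: s :: L) :=
  Relation.ReflTransGen.single ⟨[], L, s, t, h, rfl, rfl⟩

theorem cons (s : Syllable G) {L M : List (Syllable G)} (h : ShuffleEquiv adj L M) :
    ShuffleEquiv adj (s :: L) (s :: M) :=
  Relation.ReflTransGen.lift (s :: ·) (fun _ _ => ShuffleStep.cons s) _ _ h

theorem symm (hsymm : Symmetric adj) {L M : List (Syllable G)} (h : ShuffleEquiv adj L M) :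
    ShuffleEquiv adj M L := by
  induction h with
  | refl => exact refl _
  | tail _ h ih =>
    obtain ⟨A, B, s, t, hst, rfl, rfl⟩ := h
    exact Relation.ReflTransGen.head ⟨A, B, t, s, hsymm hst, rfl, rfl⟩ ih

theorem mem_iff {L M : List (Syllable G)} (h : ShuffleEquiv adj L M) (s : Syllable G) :
    s ∈ L ↔ s ∈ M := by
  induction h with
  | refl => rfl
  | tail _ h ih =>
    obtain ⟨A, B, t, u, -, rfl, rfl⟩ := h
    rw [ih]
    simp only [List.mem_append, List.mem_cons]
    tauto

end ShuffleEquiv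

open Classical in
/-- The value of the initial syllable of a word at the vertex `I`, or `1` if there is none. -/
noncomputable def leading (adj : Λ → Λ → Prop) (I : Λ) : List (Syllable G) → G I
  | [] => 1
  | s :: L => if h : s.1 = I then h ▸ (s.2.1 : G s.1)
      else if adj s.1 I then leading adj I L else 1

open Classical in
/-- A word with its initial syllable at the vertex `I` removed, if there is one. -/
noncomputable def dropLeading (adj : Λ → Λ → Prop) (I : Λ) :
    List (Syllable G) → List (Syllable G)
  | [] => []
  | s :: L => if s.1 = I then L else if adj s.1 I then s :: dropLeading adj I L else s :: L

open Classical in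
/-- Prepend an element of `G I` to a word, unless it is trivial. -/
noncomputable def push (I : Λ) (c : G I) (L : List (Syllable G)) : List (Syllable G) :=
  if h : c = 1 then L else Syllable.of I ⟨c, h⟩ :: L

/-- Recursive characterization of reduced words. -/
def IsReducedWord (adj : Λ → Λ → Prop) : List (Syllable G) → Prop
  | [] => True
  | s :: L => leading adj s.1 L = 1 ∧ IsReducedWord adj L

@[simp] theorem leading_nil (I : Λ) : leading adj I ([] : List (Syllable G)) = 1 := rfl

@[simp] theorem leading_cons_self (I : Λ) (c : {g : G I // g ≠ 1}) (L : List (Syllable G)) :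
    leading adj I (Syllable.of I c :: L) = c.1 := by
  simp [leading]

theorem leading_cons_of_adj (hirr : ∀ I, ¬ adj I I) {I : Λ} {s : Syllable G} (h : adj s.1 I)
    (L : List (Syllable G)) : leading adj I (s :: L) = leading adj I L := by
  have : s.1 ≠ I := by rintro rfl; exact hirr _ h
  simp [leading, this, h]

theorem leading_cons_of_not_adj {I : Λ} {s : Syllable G} (hne : s.1 ≠ I) (h : ¬ adj s.1 I)
    (L : List (Syllable G)) : leading adj I (s :: L) = 1 := by
  simp [leading, hne, h]

theorem dropLeading_cons_self (I : Λ) (c : {g : G I // g ≠ 1}) (L : List (Syllable G)) :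
    dropLeading adj I (Syllable.of I c :: L) = L := by
  simp [dropLeading]

theorem dropLeading_cons_of_adj (hirr : ∀ I, ¬ adj I I) {I : Λ} {s : Syllable G}
    (h : adj s.1 I) (L : List (Syllable G)) :
    dropLeading adj I (s :: L) = s :: dropLeading adj I L := by
  have : s.1 ≠ I := by rintro rfl; exact hirr _ h
  simp [dropLeading, this, h]

theorem dropLeading_cons_of_not_adj {I : Λ} {s : Syllable G} (hne : s.1 ≠ I)
    (h : ¬ adj s.1 I) (L : List (Syllable G)) : dropLeading adj I (s :: L) = s :: L := by
  simp [dropLeading, hne, h]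

@[simp] theorem push_one (I : Λ) (L : List (Syllable G)) : push I (1 : G I) L = L := by
  simp [push]

theorem push_of_ne {I : Λ} {c : G I} (h : c ≠ 1) (L : List (Syllable G)) :
    push I c L = Syllable.of I ⟨c, h⟩ :: L := by
  simp [push, h]

theorem ShuffleEquiv.push {L M : List (Syllable G)} (I : Λ) (c : G I)
    (h : ShuffleEquiv adj L M) : ShuffleEquiv adj (push I c L) (push I c M) := by
  by_cases hc : c = 1
  · subst hc; simpa using h
  · simpa only [push_of_ne hc] using h.cons _

theorem push_comm {I J : Λ} (h : adj I J) (c : G I) (d : G J) (L : List (Syllable G)) :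
    ShuffleEquiv adj (push I c (push J d L)) (push J d (push I c L)) := by
  by_cases hc : c = 1
  · subst hc; simpa using ShuffleEquiv.refl _
  by_cases hd : d = 1
  · subst hd; simpa using ShuffleEquiv.refl _
  simp only [push_of_ne hc, push_of_ne hd]
  exact ShuffleEquiv.swap (s := Syllable.of I ⟨c, hc⟩) (t := Syllable.of J ⟨d, hd⟩) h L

theorem leading_push_self {I : Λ} (c : G I) {L : List (Syllable G)} (h : leading adj I L = 1) :
    leading adj I (push I c L) = c := by
  by_cases hc : c = 1
  · subst hc; simpa using h
  · simp [push_of_ne hc]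

theorem leading_push_of_adj (hirr : ∀ I, ¬ adj I I) {I J : Λ} (h : adj J I) (c : G J)
    (L : List (Syllable G)) : leading adj I (push J c L) = leading adj I L := by
  by_cases hc : c = 1
  · subst hc; simp
  · rw [push_of_ne hc, leading_cons_of_adj hirr h]

theorem dropLeading_push_of_adj (hirr : ∀ I, ¬ adj I I) {I J : Λ} (h : adj J I) (c : G J)
    (L : List (Syllable G)) :
    dropLeading adj I (push J c L) = push J c (dropLeading adj I L) := by
  by_cases hc : c = 1
  · subst hc; simp
  · rw [push_of_ne hc, push_of_ne hc, dropLeading_cons_of_adj hirr h]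

theorem leading_append {I : Λ} (hirr : ∀ I, ¬ adj I I) (A B : List (Syllable G))
    (c : {g : G I // g ≠ 1}) (hA : ∀ a ∈ A, adj a.1 I) :
    leading adj I (A ++ Syllable.of I c :: B) = c.1 := by
  induction A with
  | nil => simp
  | cons a A ih =>
    rw [List.cons_append, leading_cons_of_adj hirr (hA a (by simp))]
    exact ih fun b hb => hA b (by simp [hb])

theorem ShuffleEquiv.leading_eq (hsymm : Symmetric adj) (hirr : ∀ I, ¬ adj I I) {I : Λ}
    {L M : List (Syllable G)} (h : ShuffleEquiv adj L M) :
    leading adj I L = leading adj I M := by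
  induction h with
  | refl => rfl
  | tail _ h ih =>
    rw [ih]
    refine ShuffleStep.induction (r := fun L M => leading adj I L = leading adj I M) ?_ ?_ h
    · intro s t B hst
      obtain ⟨S, s, rfl⟩ := s.exists_eq_of
      obtain ⟨T, t, rfl⟩ := t.exists_eq_of
      by_cases hs : S = I
      · subst hs
        rw [leading_cons_self, leading_cons_of_adj hirr (hsymm hst), leading_cons_self]
      by_cases ht : T = I
      · subst ht
        rw [leading_cons_self, leading_cons_of_adj hirr hst, leading_cons_self]
      simp only [leading, hs, ht, dite_false]
      split_ifs <;> rfl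
    · intro s L M _ ih
      simp only [leading, ih]

theorem ShuffleEquiv.dropLeading (hsymm : Symmetric adj) (hirr : ∀ I, ¬ adj I I) {I : Λ}
    {L M : List (Syllable G)} (h : ShuffleEquiv adj L M) :
    ShuffleEquiv adj (dropLeading adj I L) (dropLeading adj I M) := by
  induction h with
  | refl => exact refl _
  | tail _ h ih =>
    refine ih.trans ?_
    refine ShuffleStep.induction
      (r := fun L M => ShuffleEquiv adj (_root_.dropLeading adj I L) (_root_.dropLeading adj I M))
      ?_ ?_ h
    · intro s t B hst
      obtain ⟨S, s, rfl⟩ := s.exists_eq_of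
      obtain ⟨T, t, rfl⟩ := t.exists_eq_of
      by_cases hs : S = I
      · subst hs
        rw [dropLeading_cons_self, dropLeading_cons_of_adj hirr (hsymm hst),
          dropLeading_cons_self]
        exact refl _
      by_cases ht : T = I
      · subst ht
        rw [dropLeading_cons_self, dropLeading_cons_of_adj hirr hst, dropLeading_cons_self]
        exact refl _
      simp only [_root_.dropLeading, hs, ht, if_false]
      split_ifs <;> exact swap hst _
    · intro s L M h ih
      simp only [_root_.dropLeading]
      split_ifs
      · exact Relation.ReflTransGen.single h
      · exact ih.cons s
      · exact Relation.ReflTransGen.single (h.cons s)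

theorem shuffleEquiv_push_leading (I : Λ) (L : List (Syllable G)) :
    ShuffleEquiv adj L (push I (leading adj I L) (dropLeading adj I L)) := by
  induction L with
  | nil => exact ShuffleEquiv.of_eq (push_one I _).symm
  | cons s L ih =>
    obtain ⟨S, s, rfl⟩ := s.exists_eq_of
    by_cases hs : S = I
    · subst hs
      rw [leading_cons_self, dropLeading_cons_self, push_of_ne s.2]
      exact ShuffleEquiv.refl _
    by_cases h : adj S I
    · simp only [leading, dropLeading, hs, h, dite_false, if_false, if_true]
      refine (ih.cons (Syllable.of S s)).trans ?_
      by_cases hc : leading adj I L = 1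
      · rw [hc, push_one, push_one]
        exact ShuffleEquiv.refl _
      · rw [push_of_ne hc, push_of_ne hc]
        exact ShuffleEquiv.swap (s := Syllable.of S s) (t := Syllable.of I ⟨_, hc⟩) h _
    · rw [leading_cons_of_not_adj hs h, dropLeading_cons_of_not_adj hs h, push_one]
      exact ShuffleEquiv.refl _

theorem dropLeading_shuffleEquiv (hsymm : Symmetric adj) {I : Λ} {L : List (Syllable G)}
    (h : leading adj I L = 1) : ShuffleEquiv adj (dropLeading adj I L) L := by
  have := shuffleEquiv_push_leading (adj := adj) I L
  rw [h, push_one] at this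
  exact this.symm hsymm

theorem dropLeading_push_self (hsymm : Symmetric adj) {I : Λ} (c : G I)
    {L : List (Syllable G)} (h : leading adj I L = 1) :
    ShuffleEquiv adj (dropLeading adj I (push I c L)) L := by
  by_cases hc : c = 1
  · subst hc
    rw [push_one]
    exact dropLeading_shuffleEquiv hsymm h
  · rw [push_of_ne hc, dropLeading_cons_self]
    exact ShuffleEquiv.refl _

theorem leading_dropLeading_of_adj (hsymm : Symmetric adj) (hirr : ∀ I, ¬ adj I I) {I J : Λ}
    (h : adj J I) (L : List (Syllable G)) :
    leading adj I (dropLeading adj J L) = leading adj I L := by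
  rw [(shuffleEquiv_push_leading J L).leading_eq hsymm hirr (I := I),
    leading_push_of_adj hirr h]

theorem dropLeading_sublist (I : Λ) (L : List (Syllable G)) :
    (dropLeading adj I L).Sublist L := by
  induction L with
  | nil => exact List.Sublist.refl _
  | cons s L ih =>
    simp only [dropLeading]
    split_ifs
    · exact List.sublist_cons_self _ _
    · exact ih.cons_cons _
    · exact List.Sublist.refl _

theorem ShuffleEquiv.isReducedWord (hsymm : Symmetric adj) (hirr : ∀ I, ¬ adj I I)
    {L M : List (Syllable G)} (h : ShuffleEquiv adj L M) (hL : IsReducedWord adj L) :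
    IsReducedWord adj M := by
  induction h with
  | refl => exact hL
  | tail _ h ih =>
    refine ShuffleStep.induction (r := fun L M => IsReducedWord adj L → IsReducedWord adj M)
      ?_ ?_ h ih
    · rintro s t B hst ⟨h1, h2, h3⟩
      rw [leading_cons_of_adj hirr (hsymm hst)] at h1
      exact ⟨by rwa [leading_cons_of_adj hirr hst], h1, h3⟩
    · rintro s L M h ih ⟨h1, h2⟩
      exact ⟨by rwa [← ShuffleEquiv.leading_eq hsymm hirr (Relation.ReflTransGen.single h)],
        ih h2⟩

theorem IsReducedWord.push {I : Λ} (c : G I) {L : List (Syllable G)}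
    (h : leading adj I L = 1) (hL : IsReducedWord adj L) : IsReducedWord adj (push I c L) := by
  by_cases hc : c = 1
  · subst hc; simpa using hL
  · rw [push_of_ne hc]
    exact ⟨h, hL⟩

theorem IsReducedWord.dropLeading (hsymm : Symmetric adj) (hirr : ∀ I, ¬ adj I I) (I : Λ)
    {L : List (Syllable G)} (hL : IsReducedWord adj L) :
    IsReducedWord adj (dropLeading adj I L) ∧ leading adj I (dropLeading adj I L) = 1 := by
  have hE := shuffleEquiv_push_leading (adj := adj) I L
  by_cases hc : leading adj I L = 1
  · have hE' := dropLeading_shuffleEquiv hsymm hc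
    exact ⟨(hE'.symm hsymm).isReducedWord hsymm hirr hL,
      (hE'.leading_eq hsymm hirr).trans hc⟩
  · have h := hE.isReducedWord hsymm hirr hL
    rw [push_of_ne hc] at h
    exact ⟨h.2, h.1⟩

theorem reduced_iff_isReducedWord (hsymm : Symmetric adj) (hirr : ∀ I, ¬ adj I I)
    {L : List (Syllable G)} : Reduced adj L ↔ IsReducedWord adj L := by
  constructor
  · intro h
    induction L with
    | nil => trivial
    | cons s L ih =>
      refine ⟨?_, ih ?_⟩
      · by_contra hc
        have hE := shuffleEquiv_push_leading (adj := adj) s.1 L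
        rw [push_of_ne hc] at hE
        exact h ⟨_, hE.cons s, [], _, s, Syllable.of s.1 ⟨_, hc⟩, rfl, rfl⟩
      · rintro ⟨L', hL', A, B, t, u, htu, rfl⟩
        exact h ⟨_, hL'.cons s, s :: A, B, t, u, htu, rfl⟩
  · rintro h ⟨_, hL', A, B, s, t, hst, rfl⟩
    obtain ⟨S, s, rfl⟩ := s.exists_eq_of
    obtain ⟨T, t, rfl⟩ := t.exists_eq_of
    obtain rfl : S = T := hst
    replace h := hL'.isReducedWord hsymm hirr h
    clear hL'
    induction A with
    | nil => exact t.2 (by simpa using h.1)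
    | cons a A ih => exact ih h.2

end Words

section NormalForm

variable {Λ : Type u} (adj : Λ → Λ → Prop) (G : Λ → Type v) [∀ I, Group (G I)]

/-- Left multiplication of a word by an element of `G I`, amalgamating with the initial
syllable at `I`. -/
noncomputable def wordMul (I : Λ) (g : G I) (L : List (Syllable G)) : List (Syllable G) :=
  push I (g * leading adj I L) (dropLeading adj I L)

variable {adj G}

theorem ShuffleEquiv.wordMul (hsymm : Symmetric adj) (hirr : ∀ I, ¬ adj I I) {I : Λ} (g : G I)
    {L M : List (Syllable G)} (h : ShuffleEquiv adj L M) :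
    ShuffleEquiv adj (wordMul adj G I g L) (wordMul adj G I g M) := by
  unfold _root_.wordMul
  rw [h.leading_eq hsymm hirr]
  exact (h.dropLeading hsymm hirr).push _ _

theorem IsReducedWord.wordMul (hsymm : Symmetric adj) (hirr : ∀ I, ¬ adj I I) {I : Λ} (g : G I)
    {L : List (Syllable G)} (hL : IsReducedWord adj L) :
    IsReducedWord adj (wordMul adj G I g L) :=
  have h := hL.dropLeading hsymm hirr I
  h.1.push _ h.2

theorem wordMul_one (hsymm : Symmetric adj) (I : Λ) (L : List (Syllable G)) :
    ShuffleEquiv adj (wordMul adj G I 1 L) L := by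
  rw [wordMul, one_mul]
  exact (shuffleEquiv_push_leading I L).symm hsymm

theorem leading_wordMul_self (hsymm : Symmetric adj) (hirr : ∀ I, ¬ adj I I) {I : Λ}
    (g : G I) {L : List (Syllable G)} (hL : IsReducedWord adj L) :
    leading adj I (wordMul adj G I g L) = g * leading adj I L :=
  leading_push_self _ (hL.dropLeading hsymm hirr I).2

theorem leading_wordMul_of_adj (hsymm : Symmetric adj) (hirr : ∀ I, ¬ adj I I) {I J : Λ}
    (h : adj J I) (g : G J) (L : List (Syllable G)) :
    leading adj I (wordMul adj G J g L) = leading adj I L := by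
  rw [wordMul, leading_push_of_adj hirr h, leading_dropLeading_of_adj hsymm hirr h]

theorem wordMul_mul (hsymm : Symmetric adj) (hirr : ∀ I, ¬ adj I I) {I : Λ} (g h : G I)
    {L : List (Syllable G)} (hL : IsReducedWord adj L) :
    ShuffleEquiv adj (wordMul adj G I (g * h) L)
      (wordMul adj G I g (wordMul adj G I h L)) := by
  have key : wordMul adj G I g (wordMul adj G I h L) = push I (g * (h * leading adj I L))
      (dropLeading adj I (wordMul adj G I h L)) := by
    rw [← leading_wordMul_self hsymm hirr h hL, wordMul]
  rw [key, ← mul_assoc, wordMul]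
  exact ((dropLeading_push_self hsymm _ (hL.dropLeading hsymm hirr I).2).symm hsymm).push _ _

theorem wordMul_comm (hsymm : Symmetric adj) (hirr : ∀ I, ¬ adj I I) {I J : Λ} (hIJ : adj I J)
    (g : G I) (h : G J) {L : List (Syllable G)} (hL : IsReducedWord adj L) :
    ShuffleEquiv adj (wordMul adj G I g (wordMul adj G J h L))
      (wordMul adj G J h (wordMul adj G I g L)) := by
  have drop_comm : ShuffleEquiv adj (dropLeading adj I (dropLeading adj J L))
      (dropLeading adj J (dropLeading adj I L)) := by
    have hE := ((shuffleEquiv_push_leading I L).dropLeading hsymm hirr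
      (I := J)).dropLeading hsymm hirr (I := I)
    rw [dropLeading_push_of_adj hirr hIJ] at hE
    refine hE.trans (dropLeading_push_self hsymm _ ?_)
    rw [leading_dropLeading_of_adj hsymm hirr (hsymm hIJ)]
    exact (hL.dropLeading hsymm hirr I).2
  have expand : ∀ {I J : Λ} (_ : adj I J) (g : G I) (h : G J),
      wordMul adj G I g (wordMul adj G J h L) = push I (g * leading adj I L)
        (push J (h * leading adj J L) (dropLeading adj I (dropLeading adj J L))) := by
    intro I J hIJ g h
    rw [wordMul, leading_wordMul_of_adj hsymm hirr (hsymm hIJ), wordMul,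
      dropLeading_push_of_adj hirr (hsymm hIJ)]
  rw [expand hIJ, expand (hsymm hIJ)]
  exact (push_comm hIJ _ _ _).trans ((drop_comm.push _ _).push _ _)

/-- Reduced words up to shuffling. -/
def reducedWordSetoid (hsymm : Symmetric adj) :
    Setoid {L : List (Syllable G) // IsReducedWord adj L} where
  r L M := ShuffleEquiv adj L.1 M.1
  iseqv := ⟨fun _ => .refl _, fun h => h.symm hsymm, fun h h' => h.trans h'⟩

/-- The action of `G I` on reduced words up to shuffling. -/
noncomputable def vertexAction (hsymm : Symmetric adj) (hirr : ∀ I, ¬ adj I I) (I : Λ) :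
    G I →* Function.End (Quotient (reducedWordSetoid (G := G) hsymm)) where
  toFun g := Quotient.map' (fun L => ⟨wordMul adj G I g L.1, L.2.wordMul hsymm hirr g⟩)
    fun _ _ h => ShuffleEquiv.wordMul hsymm hirr g h
  map_one' := by
    funext q
    induction q using Quotient.inductionOn with
    | h L => exact Quotient.sound (wordMul_one hsymm I L.1)
  map_mul' g h := by
    funext q
    induction q using Quotient.inductionOn with
    | h L => exact Quotient.sound (wordMul_mul hsymm hirr g h L.2)

/-- The action of the graph product on reduced words up to shuffling. -/
noncomputable def graphProductAction (hsymm : Symmetric adj) (hirr : ∀ I, ¬ adj I I) :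
    GraphProduct adj G →* Function.End (Quotient (reducedWordSetoid (G := G) hsymm)) :=
  QuotientGroup.lift _ (Monoid.CoprodI.lift (vertexAction hsymm hirr)) <| by
    refine Subgroup.normalClosure_le_normal ?_
    rintro _ ⟨I, J, x, y, hIJ, rfl⟩
    have hcomm : vertexAction (G := G) hsymm hirr I x * vertexAction hsymm hirr J y =
        vertexAction hsymm hirr J y * vertexAction hsymm hirr I x := by
      funext q
      induction q using Quotient.inductionOn with
      | h L => exact Quotient.sound (wordMul_comm hsymm hirr hIJ x y L.2)
    rw [SetLike.mem_coe, MonoidHom.mem_ker]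
    simp only [← map_inv, map_mul, Monoid.CoprodI.lift_of]
    rw [hcomm, mul_assoc (vertexAction hsymm hirr J y), ← map_mul, mul_inv_cancel, map_one,
      mul_one, ← map_mul, mul_inv_cancel, map_one]

theorem mkOf_one (I : Λ) : mkOf adj G (1 : G I) = 1 := by
  rw [mkOf, map_one]; rfl

theorem mkOf_mul {I : Λ} (g h : G I) : mkOf adj G (g * h) = mkOf adj G g * mkOf adj G h := by
  rw [mkOf, map_mul]; rfl

theorem mkOf_inv {I : Λ} (g : G I) : mkOf adj G g⁻¹ = (mkOf adj G g)⁻¹ := by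
  rw [mkOf, map_inv]; rfl

theorem mkOf_comm {I J : Λ} (h : adj I J) (g : G I) (k : G J) :
    mkOf adj G g * mkOf adj G k = mkOf adj G k * mkOf adj G g := by
  have : mkOf adj G g * mkOf adj G k * (mkOf adj G g)⁻¹ * (mkOf adj G k)⁻¹ = 1 :=
    (QuotientGroup.eq_one_iff _).mpr (Subgroup.subset_normalClosure ⟨I, J, g, k, h, rfl⟩)
  rwa [mul_inv_eq_one, mul_inv_eq_iff_eq_mul] at this

theorem graphProductAction_mkOf (hsymm : Symmetric adj) (hirr : ∀ I, ¬ adj I I) {I : Λ}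
    (g : G I) : graphProductAction hsymm hirr (mkOf adj G g) = vertexAction hsymm hirr I g :=
  Monoid.CoprodI.lift_of _ _

@[simp] theorem evalWord_nil : evalWord adj G [] = 1 := rfl

@[simp] theorem evalWord_cons (s : Syllable G) (L : List (Syllable G)) :
    evalWord adj G (s :: L) = mkOf adj G (s.2.1 : G s.1) * evalWord adj G L := by
  simp [evalWord]

theorem evalWord_push {I : Λ} (c : G I) (L : List (Syllable G)) :
    evalWord adj G (push I c L) = mkOf adj G c * evalWord adj G L := by
  by_cases hc : c = 1
  · subst hc; simp [mkOf_one]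
  · simp [push_of_ne hc]

theorem ShuffleEquiv.evalWord_eq {L M : List (Syllable G)} (h : ShuffleEquiv adj L M) :
    evalWord adj G L = evalWord adj G M := by
  induction h with
  | refl => rfl
  | tail _ h ih =>
    rw [ih]
    refine ShuffleStep.induction (r := fun L M => evalWord adj G L = evalWord adj G M) ?_ ?_ h
    · intro s t B hst
      simp only [evalWord_cons, ← mul_assoc, mkOf_comm hst]
    · intro s L M _ ih
      simp only [evalWord_cons, ih]

theorem mkOf_leading_mul_evalWord (I : Λ) (L : List (Syllable G)) :
    mkOf adj G (leading adj I L) * evalWord adj G (dropLeading adj I L) = evalWord adj G L := by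
  rw [← evalWord_push, ← (shuffleEquiv_push_leading I L).evalWord_eq]

theorem evalWord_wordMul {I : Λ} (g : G I) (L : List (Syllable G)) :
    evalWord adj G (wordMul adj G I g L) = mkOf adj G g * evalWord adj G L := by
  rw [wordMul, evalWord_push, mkOf_mul, mul_assoc, mkOf_leading_mul_evalWord]

theorem graphProductAction_evalWord (hsymm : Symmetric adj) (hirr : ∀ I, ¬ adj I I)
    {L : List (Syllable G)} (hL : IsReducedWord adj L) :
    graphProductAction hsymm hirr (evalWord adj G L)
      (Quotient.mk (reducedWordSetoid hsymm) ⟨[], trivial⟩) =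
      Quotient.mk (reducedWordSetoid hsymm) ⟨L, hL⟩ := by
  induction L with
  | nil => rw [evalWord_nil, map_one]; rfl
  | cons s L ih =>
    rw [evalWord_cons, map_mul]
    refine (congrArg (graphProductAction hsymm hirr (mkOf adj G s.2.1)) (ih hL.2)).trans ?_
    rw [graphProductAction_mkOf]
    refine Quotient.sound ?_
    change ShuffleEquiv adj (wordMul adj G s.1 s.2.1 L) (s :: L)
    rw [wordMul, hL.1, mul_one, push_of_ne s.2.2]
    exact (dropLeading_shuffleEquiv hsymm hL.1).cons s

/-- Green's theorem: reduced words for the same element are shuffle equivalent. -/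
theorem shuffleEquiv_of_evalWord_eq (hsymm : Symmetric adj) (hirr : ∀ I, ¬ adj I I)
    {L M : List (Syllable G)} (hL : IsReducedWord adj L) (hM : IsReducedWord adj M)
    (h : evalWord adj G L = evalWord adj G M) : ShuffleEquiv adj L M := by
  have hq := graphProductAction_evalWord hsymm hirr hL
  rw [h, graphProductAction_evalWord hsymm hirr hM] at hq
  exact (Quotient.exact hq).symm hsymm

theorem exists_isReducedWord (hsymm : Symmetric adj) (hirr : ∀ I, ¬ adj I I)
    (x : GraphProduct adj G) : ∃ L, IsReducedWord adj L ∧ evalWord adj G L = x := by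
  obtain ⟨w, rfl⟩ := QuotientGroup.mk_surjective x
  induction w using Monoid.CoprodI.induction_left with
  | one => exact ⟨[], trivial, rfl⟩
  | @mul I g w ih =>
    obtain ⟨L, hL, hLw⟩ := ih
    refine ⟨wordMul adj G I g L, hL.wordMul hsymm hirr g, ?_⟩
    rw [evalWord_wordMul, hLw]
    rfl

open Classical in
/-- The initial syllable of `x` at the vertex `I`, as an element of `G I` (`1` if none). -/
noncomputable def initialPart (I : Λ) (x : GraphProduct adj G) : G I :=
  if h : ∃ L, IsReducedWord adj L ∧ evalWord adj G L = x then leading adj I h.choose else 1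

theorem initialPart_evalWord (hsymm : Symmetric adj) (hirr : ∀ I, ¬ adj I I) (I : Λ)
    {L : List (Syllable G)} (hL : IsReducedWord adj L) :
    initialPart I (evalWord adj G L) = leading adj I L := by
  have h : ∃ M, IsReducedWord adj M ∧ evalWord adj G M = evalWord adj G L := ⟨L, hL, rfl⟩
  rw [initialPart, dif_pos h]
  exact (shuffleEquiv_of_evalWord_eq hsymm hirr h.choose_spec.1 hL
    h.choose_spec.2).leading_eq hsymm hirr

theorem initialPart_mkOf_mul (hsymm : Symmetric adj) (hirr : ∀ I, ¬ adj I I) {I : Λ} (g : G I)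
    (x : GraphProduct adj G) : initialPart I (mkOf adj G g * x) = g * initialPart I x := by
  obtain ⟨L, hL, rfl⟩ := exists_isReducedWord hsymm hirr x
  rw [← evalWord_wordMul, initialPart_evalWord hsymm hirr _ (hL.wordMul hsymm hirr g),
    leading_wordMul_self hsymm hirr g hL, initialPart_evalWord hsymm hirr _ hL]

theorem initialPart_mkOf_mul_of_adj (hsymm : Symmetric adj) (hirr : ∀ I, ¬ adj I I) {I J : Λ}
    (h : adj J I) (g : G J) (x : GraphProduct adj G) :
    initialPart I (mkOf adj G g * x) = initialPart I x := by
  obtain ⟨L, hL, rfl⟩ := exists_isReducedWord hsymm hirr x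
  rw [← evalWord_wordMul, initialPart_evalWord hsymm hirr _ (hL.wordMul hsymm hirr g),
    leading_wordMul_of_adj hsymm hirr h, initialPart_evalWord hsymm hirr _ hL]

theorem initialPart_eq_one_of_not_adj (hsymm : Symmetric adj) (hirr : ∀ I, ¬ adj I I) {I J : Λ}
    (hne : J ≠ I) (h : ¬ adj J I) {x : GraphProduct adj G} (hx : initialPart J x ≠ 1) :
    initialPart I x = 1 := by
  obtain ⟨L, hL, rfl⟩ := exists_isReducedWord hsymm hirr x
  rw [initialPart_evalWord hsymm hirr _ hL] at hx ⊢
  rw [(shuffleEquiv_push_leading J L).leading_eq hsymm hirr (I := I), push_of_ne hx]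
  exact leading_cons_of_not_adj (s := Syllable.of J ⟨_, hx⟩) hne h _

theorem InitialPart.initialPart_eq (hsymm : Symmetric adj) (hirr : ∀ I, ¬ adj I I)
    {x : GraphProduct adj G} {I : Λ} {c : G I} (h : InitialPart adj G x I c) :
    initialPart I x = c := by
  rcases h with ⟨hc, L, hL, rfl, i, hi, hs⟩ | ⟨rfl, h⟩
  · replace hs : L.get i = Syllable.of I ⟨c, hc⟩ := hs
    rw [reduced_iff_isReducedWord hsymm hirr] at hL
    rw [initialPart_evalWord hsymm hirr _ hL]
    have hsplit : L = L.take i ++ Syllable.of I ⟨c, hc⟩ :: L.drop (i + 1) := by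
      rw [← hs, List.get_eq_getElem, List.cons_getElem_drop_succ, List.take_append_drop]
    rw [hsplit]
    refine leading_append hirr _ _ _ fun a ha => ?_
    obtain ⟨j, hj, rfl⟩ := List.mem_take_iff_getElem.mp ha
    have := hi ⟨j, by omega⟩ (by rw [Fin.lt_def]; simp; omega)
    rw [hs] at this
    exact this
  · obtain ⟨L, hL, rfl⟩ := exists_isReducedWord hsymm hirr x
    rw [initialPart_evalWord hsymm hirr _ hL]
    by_contra hc
    have hE := shuffleEquiv_push_leading (adj := adj) I L
    have hred := hE.isReducedWord hsymm hirr hL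
    have heval := hE.evalWord_eq
    rw [push_of_ne hc] at hred heval
    refine h ⟨Syllable.of I ⟨_, hc⟩, ⟨_, (reduced_iff_isReducedWord hsymm hirr).mpr hred,
      heval.symm, ⟨0, by simp⟩, ?_, rfl⟩, rfl⟩
    intro j hj
    exact absurd hj (by simp)

theorem mkOf_mul_comm_of_vertexOf (hsymm : Symmetric adj) (hirr : ∀ I, ¬ adj I I) {I : Λ}
    {x : GraphProduct adj G} (hx : ∀ J, VertexOf adj G x J → adj I J) (c : G I) :
    mkOf adj G c * x = x * mkOf adj G c := by
  obtain ⟨L, hL, rfl⟩ := exists_isReducedWord hsymm hirr x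
  have hadj : ∀ s ∈ L, adj I s.1 := fun s hs =>
    hx s.1 ⟨L, (reduced_iff_isReducedWord hsymm hirr).mpr hL, rfl, s, hs, rfl⟩
  clear hx hL
  induction L with
  | nil => simp
  | cons s L ih =>
    rw [evalWord_cons, ← mul_assoc, mkOf_comm (hadj s (by simp)), mul_assoc,
      ih fun t ht => hadj t (by simp [ht]), mul_assoc]

theorem initialPart_mul_of_vertexOf (hsymm : Symmetric adj) (hirr : ∀ I, ¬ adj I I) {I : Λ}
    {x : GraphProduct adj G} (hx : ∀ J, VertexOf adj G x J → adj I J)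
    (y : GraphProduct adj G) : initialPart I (x * y) = initialPart I y := by
  obtain ⟨L, hL, rfl⟩ := exists_isReducedWord hsymm hirr x
  have hadj : ∀ s ∈ L, adj I s.1 := fun s hs =>
    hx s.1 ⟨L, (reduced_iff_isReducedWord hsymm hirr).mpr hL, rfl, s, hs, rfl⟩
  clear hx hL
  induction L with
  | nil => simp
  | cons s L ih =>
    rw [evalWord_cons, mul_assoc, initialPart_mkOf_mul_of_adj hsymm hirr
      (hsymm (hadj s (by simp))), ih fun t ht => hadj t (by simp [ht])]

end NormalForm

section Positive

variable {Λ : Type u} {adj : Λ → Λ → Prop} {G : Λ → Type v} [∀ I, Group (G I)]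
  {Pc : ∀ I, Submonoid (G I)}

theorem mkOf_mem_posCone {I : Λ} {p : G I} (hp : p ∈ Pc I) :
    mkOf adj G p ∈ posCone adj G Pc :=
  Submonoid.subset_closure ⟨I, p, hp, rfl⟩

theorem evalWord_mem_posCone {L : List (Syllable G)} (hL : ∀ s ∈ L, s.2.1 ∈ Pc s.1) :
    evalWord adj G L ∈ posCone adj G Pc := by
  induction L with
  | nil => exact one_mem _
  | cons s L ih =>
    rw [evalWord_cons]
    exact mul_mem (mkOf_mem_posCone (hL s (by simp))) (ih fun t ht => hL t (by simp [ht]))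

theorem leading_mem (I : Λ) {L : List (Syllable G)} (hL : ∀ s ∈ L, s.2.1 ∈ Pc s.1) :
    leading adj I L ∈ Pc I := by
  induction L with
  | nil => exact one_mem _
  | cons s L ih =>
    obtain ⟨S, s, rfl⟩ := s.exists_eq_of
    by_cases hs : S = I
    · subst hs
      rw [leading_cons_self]
      exact hL (Syllable.of S s) (by simp)
    · simp only [leading, hs, dite_false]
      split_ifs
      · exact ih fun t ht => hL t (by simp [ht])
      · exact one_mem _

theorem push_mem {I : Λ} {c : G I} (hc : c ∈ Pc I) {L : List (Syllable G)}
    (hL : ∀ s ∈ L, s.2.1 ∈ Pc s.1) : ∀ s ∈ push I c L, s.2.1 ∈ Pc s.1 := by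
  by_cases h : c = 1
  · subst h; simpa using hL
  · rw [push_of_ne h]
    intro s hs
    rcases List.mem_cons.mp hs with rfl | hs
    · exact hc
    · exact hL s hs

/-- Every syllable of a reduced word for a positive element is positive. -/
theorem syllable_mem_of_mem_posCone (hsymm : Symmetric adj) (hirr : ∀ I, ¬ adj I I)
    {L : List (Syllable G)} (hL : IsReducedWord adj L)
    (h : evalWord adj G L ∈ posCone adj G Pc) : ∀ s ∈ L, s.2.1 ∈ Pc s.1 := by
  suffices key : ∀ x ∈ posCone adj G Pc, ∃ M, IsReducedWord adj M ∧ evalWord adj G M = x ∧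
      ∀ s ∈ M, s.2.1 ∈ Pc s.1 by
    obtain ⟨M, hM, hML, hpos⟩ := key _ h
    intro s hs
    exact hpos s (((shuffleEquiv_of_evalWord_eq hsymm hirr hM hL hML).mem_iff s).mpr hs)
  intro x hx
  induction hx using Submonoid.closure_induction_left with
  | one => exact ⟨[], trivial, rfl, by simp⟩
  | mul_left g hg y hy ih =>
    obtain ⟨I, p, hp, rfl⟩ := hg
    obtain ⟨M, hM, rfl, hpos⟩ := ih
    refine ⟨wordMul adj G I p M, hM.wordMul hsymm hirr p, evalWord_wordMul p M, ?_⟩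
    exact push_mem (mul_mem hp (leading_mem I hpos))
      fun s hs => hpos s ((dropLeading_sublist I M).subset hs)

/-- A positive element splits as its initial part at `I` times a remainder, both positive. -/
theorem exists_eq_mkOf_initialPart_mul (hsymm : Symmetric adj) (hirr : ∀ I, ¬ adj I I) (I : Λ)
    {x : GraphProduct adj G} (hx : x ∈ posCone adj G Pc) :
    initialPart I x ∈ Pc I ∧ ∃ x' ∈ posCone adj G Pc, initialPart I x' = 1 ∧
      x = mkOf adj G (initialPart I x) * x' := by
  obtain ⟨L, hL, rfl⟩ := exists_isReducedWord hsymm hirr x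
  have hpos := syllable_mem_of_mem_posCone hsymm hirr hL hx
  have hdrop := hL.dropLeading hsymm hirr I
  rw [initialPart_evalWord hsymm hirr _ hL]
  exact ⟨leading_mem I hpos, evalWord adj G (dropLeading adj I L),
    evalWord_mem_posCone fun s hs => hpos s ((dropLeading_sublist I L).subset hs),
    by rw [initialPart_evalWord hsymm hirr _ hdrop.1, hdrop.2],
    (mkOf_leading_mul_evalWord I L).symm⟩

/-- If `I` is an initial vertex of a product of positive elements but not of the first factor,
then `I` is adjacent to every vertex of the first factor. -/
theorem adj_of_initialPart_mul_ne_one (hsymm : Symmetric adj) (hirr : ∀ I, ¬ adj I I)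
    (hpo : ∀ I, IsPoGroup (Pc I)) {I : Λ} {x p : GraphProduct adj G}
    (hx : x ∈ posCone adj G Pc) (hp : p ∈ posCone adj G Pc) (hxI : initialPart I x = 1)
    (hxp : initialPart I (x * p) ≠ 1) : ∀ J, VertexOf adj G x J → adj I J := by
  rintro _ ⟨L, hL, rfl, s, hs, rfl⟩
  rw [reduced_iff_isReducedWord hsymm hirr] at hL
  have hpos := syllable_mem_of_mem_posCone hsymm hirr hL hx
  clear hx
  induction L with
  | nil => simp at hs
  | cons t L ih =>
    have ht : t.2.1 ∈ Pc t.1 := hpos t (by simp)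
    replace hpos : ∀ s ∈ L, s.2.1 ∈ Pc s.1 := fun s hs => hpos s (by simp [hs])
    have htL : initialPart t.1 (evalWord adj G (t :: L)) = t.2.1 := by
      rw [evalWord_cons, initialPart_mkOf_mul hsymm hirr, initialPart_evalWord hsymm hirr _ hL.2,
        hL.1, mul_one]
    have hne : t.1 ≠ I := by
      rintro rfl
      exact t.2.2 (htL.symm.trans hxI)
    have hlead : initialPart t.1 (evalWord adj G (t :: L) * p) ≠ 1 := by
      rw [evalWord_cons, mul_assoc, initialPart_mkOf_mul hsymm hirr]
      intro h
      have hmem := (exists_eq_mkOf_initialPart_mul hsymm hirr t.1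
        (mul_mem (evalWord_mem_posCone hpos) hp)).1
      rw [← inv_eq_of_mul_eq_one_right h] at hmem
      exact t.2.2 (hpo _ _ ht hmem)
    have hadj : adj t.1 I := by
      by_contra hadj
      exact hxp (initialPart_eq_one_of_not_adj hsymm hirr hne hadj hlead)
    rw [evalWord_cons, initialPart_mkOf_mul_of_adj hsymm hirr hadj] at hxI
    rw [evalWord_cons, mul_assoc, initialPart_mkOf_mul_of_adj hsymm hirr hadj] at hxp
    rcases List.mem_cons.mp hs with rfl | hs
    · exact hsymm hadj
    · exact ih hL.2 hxI hxp hs hpos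

/-- Comparison of the initial parts and of the remainders of `x ≤ z`. -/
theorem lle_split (hsymm : Symmetric adj) (hirr : ∀ I, ¬ adj I I)
    (hpo : ∀ I, IsPoGroup (Pc I)) {I : Λ} {xI zI : G I} {x' z' : GraphProduct adj G}
    (hx' : x' ∈ posCone adj G Pc) (hxI : initialPart I x' = 1) (hzI : initialPart I z' = 1)
    (h : lle (posCone adj G Pc) (mkOf adj G xI * x') (mkOf adj G zI * z')) :
    lle (Pc I) xI zI ∧ lle (posCone adj G Pc) x' z' ∧
      (zI = xI ∨ ∀ J, VertexOf adj G x' J → adj I J) := by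
  obtain ⟨p, hp, hxp⟩ : ∃ p ∈ posCone adj G Pc, x' * p = mkOf adj G (xI⁻¹ * zI) * z' := by
    refine ⟨_, h, ?_⟩
    rw [mkOf_mul, mkOf_inv]
    group
  have hini : initialPart I (x' * p) = xI⁻¹ * zI := by
    rw [hxp, initialPart_mkOf_mul hsymm hirr, hzI, mul_one]
  have hle : lle (Pc I) xI zI := by
    rw [lle, ← hini]
    exact (exists_eq_mkOf_initialPart_mul hsymm hirr I (mul_mem hx' hp)).1
  refine ⟨hle, ?_⟩
  by_cases hc : xI⁻¹ * zI = 1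
  · rw [hc, mkOf_one, one_mul] at hxp
    exact ⟨by rwa [lle, ← hxp, inv_mul_cancel_left], Or.inl (inv_mul_eq_one.mp hc).symm⟩
  · have hadj := adj_of_initialPart_mul_ne_one hsymm hirr hpo hx' hp hxI (by rwa [hini])
    refine ⟨?_, Or.inr hadj⟩
    obtain ⟨-, p', hp', -, hpp'⟩ := exists_eq_mkOf_initialPart_mul hsymm hirr I hp
    rw [initialPart_mul_of_vertexOf hsymm hirr hadj] at hini
    rw [hini] at hpp'
    rw [hpp', ← mul_assoc, ← mkOf_mul_comm_of_vertexOf hsymm hirr hadj, mul_assoc] at hxp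
    rwa [lle, ← mul_left_cancel hxp, inv_mul_cancel_left]

/-- If `xI ≤ m` and `x' ≤ m'`, then `xI x' ≤ m m'` as soon as `xI = m` or `I` is adjacent to
every vertex of `x'`. -/
theorem lle_mkOf_mul (hsymm : Symmetric adj) (hirr : ∀ I, ¬ adj I I) {I : Λ} {xI m : G I}
    {x' m' : GraphProduct adj G} (hI : lle (Pc I) xI m) (h' : lle (posCone adj G Pc) x' m')
    (h : xI = m ∨ ∀ J, VertexOf adj G x' J → adj I J) :
    lle (posCone adj G Pc) (mkOf adj G xI * x') (mkOf adj G m * m') := by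
  rcases h with rfl | h
  · simpa only [lle, mul_inv_rev, mul_assoc, inv_mul_cancel_left] using h'
  · have hcomm := mkOf_mul_comm_of_vertexOf hsymm hirr h (xI⁻¹ * m)
    have : (mkOf adj G xI * x')⁻¹ * (mkOf adj G m * m') =
        mkOf adj G (xI⁻¹ * m) * (x'⁻¹ * m') := by
      calc (mkOf adj G xI * x')⁻¹ * (mkOf adj G m * m')
          = x'⁻¹ * mkOf adj G (xI⁻¹ * m) * m' := by rw [mkOf_mul, mkOf_inv]; group
        _ = mkOf adj G (xI⁻¹ * m) * (x'⁻¹ * m') := by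
          rw [(Commute.inv_left (show Commute x' _ from hcomm.symm)).eq, mul_assoc]
    rw [lle, this]
    exact mul_mem (mkOf_mem_posCone hI) h'

end Positive

section PartialOrder

variable {H : Type*} [Group H] {P : Submonoid H}

theorem lle_refl (x : H) : lle P x x := by
  rw [lle, inv_mul_cancel]
  exact one_mem P

theorem IsPoGroup.lle_antisymm (hP : IsPoGroup P) {x y : H} (h : lle P x y) (h' : lle P y x) :
    x = y :=
  inv_mul_eq_one.mp (hP _ h (by rwa [mul_inv_rev, inv_inv]))

theorem mem_of_lle {x y : H} (hx : x ∈ P) (h : lle P x y) : y ∈ P := by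
  have := mul_mem hx h
  rwa [mul_inv_cancel_left] at this

end PartialOrder

/-- Proposition 3.9. Let `(G,P)` be a graph product of quasi-lattice
ordered groups, `x, y ∈ P`, and for an arbitrary `I ∈ Λ` write `x = x_I x′`,
`y = y_I y′`.  Then (i) `x` and `y` have a common upper bound iff they are `I`-adjacent
and `x′ ∨ y′ ≠ ∞`; and (ii) if they do have a common upper bound then
`x ∨ y = (x_I ∨ y_I)·(x′ ∨ y′)`. -/
theorem lub_graphProduct_inductive_step {Λ : Type u} (adj : Λ → Λ → Prop)
    (hsymm : Symmetric adj) (hirr : ∀ I : Λ, ¬ adj I I)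
    (G : Λ → Type v) [∀ I, Group (G I)]
    (Pc : ∀ I, Submonoid (G I)) (hqlo : ∀ I, IsQLO (Pc I))
    (x y : GraphProduct adj G)
    (hx : x ∈ posCone adj G Pc) (hy : y ∈ posCone adj G Pc)
    (I : Λ) (xI yI : G I)
    (hxI : InitialPart adj G x I xI) (hyI : InitialPart adj G y I yI)
    (x' y' : GraphProduct adj G)
    (hx' : x = mkOf adj G xI * x') (hy' : y = mkOf adj G yI * y') :
    (HasUB (posCone adj G Pc) x y ↔
      (IAdjacent adj G Pc I xI yI x' y' ∧ HasUB (posCone adj G Pc) x' y')) ∧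
    (∀ (mI : G I) (m' : GraphProduct adj G),
      HasUB (posCone adj G Pc) x y →
      IsLub' (Pc I) xI yI mI →
      IsLub' (posCone adj G Pc) x' y' m' →
      IsLub' (posCone adj G Pc) x y (mkOf adj G mI * m')) := by
  have hpo : ∀ I, IsPoGroup (Pc I) := fun I => (hqlo I).1
  have remainder : ∀ {x : GraphProduct adj G} {xI : G I} {x' : GraphProduct adj G},
      x ∈ posCone adj G Pc → InitialPart adj G x I xI → x = mkOf adj G xI * x' →
      x' ∈ posCone adj G Pc ∧ initialPart I x' = 1 := by
    intro x xI x' hx hxI hx'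
    have hini := hxI.initialPart_eq hsymm hirr
    obtain ⟨-, w, hw, hwI, hxw⟩ := exists_eq_mkOf_initialPart_mul hsymm hirr I hx
    rw [hini, hx'] at hxw
    rw [mul_left_cancel hxw]
    exact ⟨hw, hwI⟩
  obtain ⟨hxP, hx1⟩ := remainder hx hxI hx'
  obtain ⟨hyP, hy1⟩ := remainder hy hyI hy'
  have split : ∀ z, lle (posCone adj G Pc) x z → lle (posCone adj G Pc) y z →
      ∃ (zI : G I) (z' : GraphProduct adj G), z = mkOf adj G zI * z' ∧
        (lle (Pc I) xI zI ∧ lle (posCone adj G Pc) x' z' ∧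
          (zI = xI ∨ ∀ J, VertexOf adj G x' J → adj I J)) ∧
        (lle (Pc I) yI zI ∧ lle (posCone adj G Pc) y' z' ∧
          (zI = yI ∨ ∀ J, VertexOf adj G y' J → adj I J)) := by
    intro z hxz hyz
    obtain ⟨-, z', -, hz1, hz⟩ :=
      exists_eq_mkOf_initialPart_mul hsymm hirr I (mem_of_lle hx hxz)
    rw [hx', hz] at hxz
    rw [hy', hz] at hyz
    exact ⟨_, z', hz, lle_split hsymm hirr hpo hxP hx1 hz1 hxz,
      lle_split hsymm hirr hpo hyP hy1 hz1 hyz⟩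
  have adjacent : HasUB (posCone adj G Pc) x y →
      IAdjacent adj G Pc I xI yI x' y' ∧ HasUB (posCone adj G Pc) x' y' := by
    rintro ⟨z, hxz, hyz⟩
    obtain ⟨zI, z', -, ⟨hx1, hx2, hx3⟩, ⟨hy1, hy2, hy3⟩⟩ := split z hxz hyz
    refine ⟨⟨⟨zI, hx1, hy1⟩, hx3.imp_left ?_, hy3.imp_left ?_⟩, z', hx2, hy2⟩
    · rintro rfl
      exact ⟨lle_refl _, hy1, fun w hw _ => hw⟩
    · rintro rfl
      exact ⟨hx1, lle_refl _, fun w _ hw => hw⟩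
  have upper : ∀ {mI : G I} {m' : GraphProduct adj G}, IAdjacent adj G Pc I xI yI x' y' →
      IsLub' (Pc I) xI yI mI → lle (posCone adj G Pc) x' m' → lle (posCone adj G Pc) y' m' →
      lle (posCone adj G Pc) x (mkOf adj G mI * m') ∧
        lle (posCone adj G Pc) y (mkOf adj G mI * m') := by
    rintro mI m' ⟨-, hb, hc⟩ ⟨hm1, hm2, hm3⟩ hxm hym
    rw [hx', hy']
    refine ⟨lle_mkOf_mul hsymm hirr hm1 hxm (hb.imp_left fun h => ?_),
      lle_mkOf_mul hsymm hirr hm2 hym (hc.imp_left fun h => ?_)⟩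
    · exact (hpo I).lle_antisymm hm1 (hm3 _ h.1 h.2.1)
    · exact (hpo I).lle_antisymm hm2 (hm3 _ h.1 h.2.1)
  refine ⟨⟨adjacent, ?_⟩, ?_⟩
  · rintro ⟨hadj, m', hxm, hym⟩
    obtain ⟨mI, hmI⟩ := (hqlo I).2 xI yI hadj.1
    exact ⟨_, upper hadj hmI hxm hym⟩
  · intro mI m' hub hmI hm'
    obtain ⟨hxm, hym⟩ := upper (adjacent hub).1 hmI hm'.1 hm'.2.1
    refine ⟨hxm, hym, fun z hxz hyz => ?_⟩
    obtain ⟨zI, z', rfl, ⟨hx1, hx2, hx3⟩, ⟨hy1, hy2, hy3⟩⟩ := split z hxz hyz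
    have hmz : lle (Pc I) mI zI := hmI.2.2 _ hx1 hy1
    have bound : ∀ {uI : G I} {u' : GraphProduct adj G}, lle (Pc I) uI mI →
        lle (posCone adj G Pc) u' z' → (zI = uI ∨ ∀ J, VertexOf adj G u' J → adj I J) →
        lle (posCone adj G Pc) u' (mkOf adj G (mI⁻¹ * zI) * z') := by
      intro uI u' hu hu' h
      have := lle_mkOf_mul hsymm hirr (xI := 1) (m := mI⁻¹ * zI)
        (by rwa [lle, inv_one, one_mul]) hu' (h.imp_left fun h => ?_)
      · rwa [mkOf_one, one_mul] at this
      · subst h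
        rw [(hpo I).lle_antisymm hmz hu, inv_mul_cancel]
    have := hm'.2.2 _ (bound hmI.1 hx2 hx3) (bound hmI.2.1 hy2 hy3)
    rw [mkOf_mul, mkOf_inv] at this
    simpa only [lle, mul_inv_rev, mul_assoc] using this
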